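/- Let h, k ∈ F_q[x] with k(c) ∈ F_q \ {0} for every c ∈ F_q, let f ∈ F_{q^n}[x], and set P(x) = f(Tr_{q^n/q}(x)) + k(Tr_{q^n/q}(x))·L_h(x) ∈ F_{q^n}[x]. Then P is a permutation polynomial of F_{q^n} if and only if both (1) gcd(h(x), (x^n − 1)/(x − 1)) = 1 in F_q[x], and (2) Q(x) := T_n[f](x) + k(x)·h(1)·x ∈ F_q[x] is a permutation polynomial of F_q. -/

import Mathlib

open Polynomial

/-- The linearized `q`-associate of `f ∈ 𝔽_q[x]`, evaluated on an extension field: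
`L_f(y) = Σ aᵢ y^(qⁱ)` where `q` is the cardinality of `Fq`. -/
noncomputable def Lq {Fq Fqn : Type*} [Field Fq] [Fintype Fq] [Field Fqn] [Algebra Fq Fqn]
    (f : Polynomial Fq) (y : Fqn) : Fqn :=
  f.sum fun i a => algebraMap Fq Fqn a * y ^ (Fintype.card Fq) ^ i

/-- `T_n[f](x) = Σ Tr(aᵢ) xⁱ ∈ 𝔽_q[x]` for `f = Σ aᵢ xⁱ ∈ 𝔽_{qⁿ}[x]`, where `Tr` is the
field trace from `𝔽_{qⁿ}` onto `𝔽_q`. -/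
noncomputable def Tn (Fq : Type*) {Fqn : Type*} [Field Fq] [Field Fqn] [Algebra Fq Fqn]
    (f : Polynomial Fqn) : Polynomial Fq :=
  f.sum fun i a => C (Algebra.trace Fq Fqn a) * X ^ i

/-- A nonunit factor of the minimal polynomial of an endomorphism acts with nontrivial kernel. -/
theorem exists_ne_zero_aeval_apply_eq_zero_of_dvd_minpoly {K V : Type*} [Field K]
    [AddCommGroup V] [Module K V] [FiniteDimensional K V] (φ : Module.End K V)
    {d : K[X]} (hd : d ∣ minpoly K φ) (hu : ¬ IsUnit d) :
    ∃ x : V, x ≠ 0 ∧ aeval φ d x = 0 := by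
  obtain ⟨e, he⟩ := hd
  by_contra! hker
  have hinj : Function.Injective (aeval φ d) := by
    rw [injective_iff_map_eq_zero]
    exact fun x hx => by_contra fun hx0 => hker x hx0 hx
  have hmin : minpoly K φ ≠ 0 := minpoly.ne_zero (Algebra.IsIntegral.isIntegral φ)
  have he0 : aeval φ e = 0 := by
    ext x
    apply hinj
    rw [← Module.End.mul_apply, ← map_mul, ← he]
    simp
  have hdvd : d * e ∣ 1 * e := by
    rw [← he, one_mul]
    exact minpoly.dvd K φ he0
  have hne : e ≠ 0 := right_ne_zero_of_mul (he ▸ hmin)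
  exact hu (isUnit_of_dvd_one ((mul_dvd_mul_iff_right hne).mp hdvd))

/-- The linearized `q`-associate of `f` is `f` evaluated at the Frobenius endomorphism. -/
theorem Lq_eq_aeval_frobenius {Fq Fqn : Type*} [Field Fq] [Fintype Fq] [Field Fqn]
    [Algebra Fq Fqn] (f : Fq[X]) (y : Fqn) :
    Lq f y = aeval (FiniteField.frobeniusAlgHom Fq Fqn).toLinearMap f y := by
  rw [Lq, aeval_eq_sum_range, Polynomial.sum_over_range _ (by simp), LinearMap.sum_apply]
  refine Finset.sum_congr rfl fun i _ => ?_
  rw [LinearMap.smul_apply, Algebra.smul_def, Module.End.coe_pow, AlgHom.coe_toLinearMap,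
    FiniteField.coe_frobeniusAlgHom, pow_iterate]

theorem X_pow_sub_one_div_X_sub_one {K : Type*} [Field K] (n : ℕ) :
    ((X ^ n - 1) / (X - 1) : K[X]) = ∑ i ∈ Finset.range n, X ^ i := by
  rw [← geom_sum_mul]
  exact mul_div_cancel_right₀ _ (by simpa using X_sub_C_ne_zero (1 : K))

/-- The trace of a finite field extension is the linearized associate of `(xⁿ - 1)/(x - 1)`. -/
theorem algebraMap_trace_eq_Lq {Fq Fqn : Type*} [Field Fq] [Fintype Fq] [Field Fqn] [Finite Fqn]
    [Algebra Fq Fqn] (y : Fqn) :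
    algebraMap Fq Fqn (Algebra.trace Fq Fqn y) =
      Lq ((X ^ Module.finrank Fq Fqn - 1) / (X - 1) : Fq[X]) y := by
  rw [X_pow_sub_one_div_X_sub_one, Lq_eq_aeval_frobenius,
    FiniteField.algebraMap_trace_eq_sum_pow, map_sum, LinearMap.sum_apply]
  refine Finset.sum_congr rfl fun i _ => ?_
  rw [map_pow, aeval_X, Module.End.coe_pow, AlgHom.coe_toLinearMap,
    FiniteField.coe_frobeniusAlgHom, pow_iterate, Nat.card_eq_fintype_card]

/-- `L_h` is injective on the kernel of the trace iff `h` is coprime to `(xⁿ - 1)/(x - 1)`. -/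
theorem gcd_eq_one_iff_Lq_ne_zero {Fq Fqn : Type*} [Field Fq] [Fintype Fq] [DecidableEq Fq]
    [Field Fqn] [Finite Fqn] [Algebra Fq Fqn] (h : Fq[X]) :
    gcd h ((X ^ Module.finrank Fq Fqn - 1) / (X - 1) : Fq[X]) = 1 ↔
      ∀ x : Fqn, Algebra.trace Fq Fqn x = 0 → Lq h x = 0 → x = 0 := by
  have htr (x : Fqn) : Algebra.trace Fq Fqn x = 0 ↔
      Lq ((X ^ Module.finrank Fq Fqn - 1) / (X - 1) : Fq[X]) x = 0 := by
    rw [← algebraMap_trace_eq_Lq, FaithfulSMul.algebraMap_eq_zero_iff]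
  have hgm : ((X ^ Module.finrank Fq Fqn - 1) / (X - 1) : Fq[X]) ∣
      minpoly Fq (FiniteField.frobeniusAlgHom Fq Fqn).toLinearMap := by
    rw [FiniteField.minpoly_frobeniusAlgHom, X_pow_sub_one_div_X_sub_one, ← geom_sum_mul]
    exact dvd_mul_right _ _
  simp only [htr, Lq_eq_aeval_frobenius]
  generalize ((X ^ Module.finrank Fq Fqn - 1) / (X - 1) : Fq[X]) = g at hgm ⊢
  constructor
  · intro hg x hgx hhx
    obtain ⟨a, b, hab⟩ : IsCoprime h g := by
      rw [← gcd_isUnit_iff, hg]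
      exact isUnit_one
    simpa [hgx, hhx] using
      (congrArg (fun p => aeval (FiniteField.frobeniusAlgHom Fq Fqn).toLinearMap p x) hab).symm
  · intro hker
    by_contra hg
    have hu : ¬ IsUnit (gcd h g) := fun hu => hg (by
      rw [← normalize_gcd, normalize_eq_one]
      exact hu)
    obtain ⟨x, hx0, hx⟩ := exists_ne_zero_aeval_apply_eq_zero_of_dvd_minpoly
      (FiniteField.frobeniusAlgHom Fq Fqn).toLinearMap ((gcd_dvd_right h g).trans hgm) hu
    have hvanish {p : Fq[X]} (hp : gcd h g ∣ p) :
        aeval (FiniteField.frobeniusAlgHom Fq Fqn).toLinearMap p x = 0 := by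
      obtain ⟨c, rfl⟩ := hp
      rw [mul_comm, map_mul, Module.End.mul_apply, hx, map_zero]
    exact hx0 (hker x (hvanish (gcd_dvd_right h g)) (hvanish (gcd_dvd_left h g)))

theorem trace_pow_card_pow {Fq Fqn : Type*} [Field Fq] [Fintype Fq] [Field Fqn]
    [Finite Fqn] [Algebra Fq Fqn] (x : Fqn) (i : ℕ) :
    Algebra.trace Fq Fqn (x ^ Fintype.card Fq ^ i) = Algebra.trace Fq Fqn x := by
  have h := Algebra.trace_eq_of_algEquiv
    (FiniteField.frobeniusAlgEquivOfAlgebraic Fq Fqn ^ i) x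
  rwa [AlgEquiv.coe_pow, FiniteField.coe_frobeniusAlgEquivOfAlgebraic_iterate] at h

theorem trace_Lq {Fq Fqn : Type*} [Field Fq] [Fintype Fq] [Field Fqn] [Finite Fqn]
    [Algebra Fq Fqn] (h : Fq[X]) (x : Fqn) :
    Algebra.trace Fq Fqn (Lq h x) = h.eval 1 * Algebra.trace Fq Fqn x := by
  simp [Lq, Polynomial.sum, eval_eq_sum, ← Algebra.smul_def, trace_pow_card_pow, Finset.sum_mul]

theorem trace_eval_algebraMap {Fq Fqn : Type*} [Field Fq] [Field Fqn]
    [Algebra Fq Fqn] (f : Fqn[X]) (c : Fq) :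
    Algebra.trace Fq Fqn (f.eval (algebraMap Fq Fqn c)) = (Tn Fq f).eval c := by
  rw [eval_eq_sum]
  simp only [Tn, Polynomial.sum, eval_finsetSum, map_sum, eval_mul, eval_C, eval_pow, eval_X]
  refine Finset.sum_congr rfl fun i _ => ?_
  rw [← map_pow, mul_comm, ← Algebra.smul_def, map_smul, smul_eq_mul, mul_comm]

/-- Let `h, k ∈ 𝔽_q[x]` with `k(c) ≠ 0` for every `c ∈ 𝔽_q`, and `f ∈ 𝔽_{qⁿ}[x]`. Then
`P(x) = f(Tr(x)) + k(Tr(x))·L_h(x)` is a PP of `𝔽_{qⁿ}` iff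
`gcd(h, (xⁿ-1)/(x-1)) = 1` in `𝔽_q[x]` and `Q(x) = T_n[f](x) + k(x)·h(1)·x`
is a PP of `𝔽_q`. -/
theorem trace_PP_iff {Fq Fqn : Type*} [Field Fq] [Fintype Fq] [DecidableEq Fq]
    [Field Fqn] [Algebra Fq Fqn]
    {n : ℕ} (hn : 0 < n) (hrank : Module.finrank Fq Fqn = n)
    (h k : Polynomial Fq) (hk : ∀ c : Fq, k.eval c ≠ 0)
    (f : Polynomial Fqn) :
    Function.Bijective (fun x : Fqn =>
        f.eval (algebraMap Fq Fqn (Algebra.trace Fq Fqn x)) +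
          algebraMap Fq Fqn (k.eval (Algebra.trace Fq Fqn x)) * Lq h x) ↔
      (gcd h ((X ^ n - 1) / (X - 1) : Polynomial Fq) = 1 ∧
        Function.Bijective fun c : Fq =>
          (Tn Fq f + k * C (h.eval 1) * X : Polynomial Fq).eval c) := by
  subst hrank
  have : FiniteDimensional Fq Fqn := Module.finite_of_finrank_pos hn
  have : Finite Fqn := Module.finite_of_finite Fq
  rw [gcd_eq_one_iff_Lq_ne_zero]
  set P : Fqn → Fqn := fun x =>
    f.eval (algebraMap Fq Fqn (Algebra.trace Fq Fqn x)) +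
      algebraMap Fq Fqn (k.eval (Algebra.trace Fq Fqn x)) * Lq h x with hP
  set Q : Fq → Fq := fun c => (Tn Fq f + k * C (h.eval 1) * X : Fq[X]).eval c with hQ
  have hsemi (x : Fqn) : Algebra.trace Fq Fqn (P x) = Q (Algebra.trace Fq Fqn x) := by
    simp only [hP, hQ, map_add, trace_eval_algebraMap, ← Algebra.smul_def, map_smul, trace_Lq,
      eval_add, eval_mul, eval_C, eval_X, smul_eq_mul, mul_assoc]
  have hfiber {x y : Fqn} (hxy : Algebra.trace Fq Fqn x = Algebra.trace Fq Fqn y) :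
      P x = P y ↔ Lq h (x - y) = 0 := by
    have hk' : algebraMap Fq Fqn (k.eval (Algebra.trace Fq Fqn y)) ≠ 0 := by
      simpa using hk _
    simp only [hP, hxy, add_right_inj, mul_right_inj' hk']
    rw [Lq_eq_aeval_frobenius, Lq_eq_aeval_frobenius, Lq_eq_aeval_frobenius, map_sub, sub_eq_zero]
  constructor
  · intro hbij
    refine ⟨fun x hx hLx => hbij.1 ((hfiber (by simpa using hx)).2 (by simpa using hLx)), ?_⟩
    refine Function.Surjective.bijective_of_finite fun c => ?_
    obtain ⟨y, rfl⟩ := Algebra.trace_surjective Fq Fqn c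
    obtain ⟨x, rfl⟩ := hbij.2 y
    exact ⟨_, (hsemi x).symm⟩
  · rintro ⟨hker, hQbij⟩
    refine Function.Injective.bijective_of_finite fun x y hxy => ?_
    have htr : Algebra.trace Fq Fqn x = Algebra.trace Fq Fqn y :=
      hQbij.1 (by rw [← hsemi, ← hsemi, hxy])
    exact sub_eq_zero.mp (hker _ (by rw [map_sub, htr, sub_self]) ((hfiber htr).1 hxy))
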